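/- Suppose σ' is bounded and Lipschitz, |σ'(z)| ≤ c and |σ'(z₁) − σ'(z₂)| ≤ c|z₁ − z₂| for all z, z₁, z₂, and ‖x_i‖₂ ≤ C for all i ∈ [N]. Then for any two first-layer weight configurations W = (w_1, …, w_m) and W̃ = (w̃_1, …, w̃_m), the corresponding Gram matrices satisfy the entrywise bound |H_{ij}(W) − H_{ij}(W̃)| ≤ (C'/m) Σ_{r=1}^m ‖w_r − w̃_r‖₂ for all i, j ∈ [N], where C' is a constant depending only on c and C. -/

import Mathlib

open MeasureTheory ProbabilityTheory Filter

noncomputable section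

/-- Dot product on `ℝ^d`. -/
def dot {d : ℕ} (v w : Fin d → ℝ) : ℝ := ∑ k, v k * w k

/-- Euclidean norm of a vector in `ℝ^d`. -/
def enorm2 {d : ℕ} (v : Fin d → ℝ) : ℝ := Real.sqrt (∑ k, (v k) ^ 2)

/-- Output of the two-layer network `u(W,a,x) = (1/√m) ∑_r a_r σ(w_rᵀ x)`. -/
def netOut {d m : ℕ} (σ : ℝ → ℝ) (W : Fin m → Fin d → ℝ) (a : Fin m → ℝ)
    (x : Fin d → ℝ) : ℝ :=
  (1 / Real.sqrt m) * ∑ r, a r * σ (dot (W r) x)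

/-- Quadratic loss `L(W,a) = ∑_i (1/2)|y_i - u(W,a,x_i)|²`. -/
def quadLoss {d m N : ℕ} (σ : ℝ → ℝ) (x : Fin N → Fin d → ℝ) (y : Fin N → ℝ)
    (W : Fin m → Fin d → ℝ) (a : Fin m → ℝ) : ℝ :=
  ∑ i, (1 / 2) * (y i - netOut σ W a (x i)) ^ 2

/-- Gradient of the quadratic loss with respect to the neuron weight `w_r`:
`∂L/∂w_r = -∑_i (y_i - u_i) (1/√m) a_r σ'(w_rᵀ x_i) x_i`. -/
def gradLoss {d m N : ℕ} (σ : ℝ → ℝ) (x : Fin N → Fin d → ℝ) (y : Fin N → ℝ)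
    (W : Fin m → Fin d → ℝ) (a : Fin m → ℝ) (r : Fin m) : Fin d → ℝ :=
  fun j => -∑ i, (y i - netOut σ W a (x i)) * (1 / Real.sqrt m) * a r
      * deriv σ (dot (W r) (x i)) * x i j

/-- Gradient of the network output `u_i` with respect to the neuron weight `w_r`:
`∂u_i/∂w_r = (1/√m) a_r σ'(w_rᵀ x_i) x_i`. -/
def gradU {d m : ℕ} (σ : ℝ → ℝ) (a : Fin m → ℝ) (xi : Fin d → ℝ)
    (W : Fin m → Fin d → ℝ) (r : Fin m) : Fin d → ℝ :=
  fun j => (1 / Real.sqrt m) * a r * deriv σ (dot (W r) xi) * xi j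

/-- Gram matrix `H(W)_{ij} = ∑_r ⟨∂u_i/∂w_r, ∂u_j/∂w_r⟩
  = (1/m) ∑_r x_iᵀx_j σ'(w_rᵀx_i) σ'(w_rᵀx_j)` (for output weights `a_r ∈ {±1}`). -/
def gram {d m N : ℕ} (σ : ℝ → ℝ) (x : Fin N → Fin d → ℝ)
    (W : Fin m → Fin d → ℝ) : Fin N → Fin N → ℝ :=
  fun i j => (1 / (m : ℝ)) * ∑ r, dot (x i) (x j)
      * deriv σ (dot (W r) (x i)) * deriv σ (dot (W r) (x j))

/-- The standard Gaussian measure `N(0, I_d)` on `ℝ^d`. -/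
def stdGaussian (d : ℕ) : Measure (Fin d → ℝ) := Measure.pi fun _ => gaussianReal 0 1

/-- Limit Gram matrix `H^∞_{ij} = x_iᵀx_j E_{w∼N(0,I)}[σ'(wᵀx_i) σ'(wᵀx_j)]`. -/
def gramInf {d N : ℕ} (σ : ℝ → ℝ) (x : Fin N → Fin d → ℝ) : Fin N → Fin N → ℝ :=
  fun i j => dot (x i) (x j) *
    ∫ w, deriv σ (dot w (x i)) * deriv σ (dot w (x j)) ∂(stdGaussian d)

/-- Smallest eigenvalue of a symmetric matrix, as the minimum of the Rayleigh
quotient over the unit sphere. -/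
def lambdaMin {N : ℕ} (H : Fin N → Fin N → ℝ) : ℝ :=
  ⨅ v : {v : Fin N → ℝ // ∑ i, (v i) ^ 2 = 1}, ∑ i, ∑ j, v.1 i * H i j * v.1 j

/-- Spectral (operator) norm of a matrix, as the supremum of `‖Hv‖₂` over the
unit sphere. -/
def specNorm {N : ℕ} (H : Fin N → Fin N → ℝ) : ℝ :=
  ⨆ v : {v : Fin N → ℝ // ∑ i, (v i) ^ 2 = 1}, enorm2 (fun i => ∑ j, H i j * v.1 j)

/-- Assumption 1: σ is smooth, analytic, not a polynomial, `|σ(0)| ≤ C`, and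
both σ and σ' are `c`-Lipschitz. -/
def Assumption1 (σ : ℝ → ℝ) (c C : ℝ) : Prop :=
  ContDiff ℝ (⊤ : ℕ∞) σ ∧ AnalyticOn ℝ σ Set.univ ∧
    (¬∃ p : Polynomial ℝ, ∀ z, σ z = Polynomial.eval z p) ∧
    |σ 0| ≤ C ∧ (∀ z₁ z₂, |σ z₁ - σ z₂| ≤ c * |z₁ - z₂|) ∧
    (∀ z₁ z₂, |deriv σ z₁ - deriv σ z₂| ≤ c * |z₁ - z₂|)

/-- Assumption 2: no two input data are parallel. -/
def Assumption2 {d N : ℕ} (x : Fin N → Fin d → ℝ) : Prop :=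
  ∀ i j : Fin N, i ≠ j → ∀ c : ℝ, x i ≠ c • x j

/-- The implicit gradient descent (IGD) recursion on the first layer:
`W(n+1) = W(n) - α ∂L(W(n+1),a)/∂W(n+1)`. -/
def IGD {d m N : ℕ} (σ : ℝ → ℝ) (x : Fin N → Fin d → ℝ) (y : Fin N → ℝ)
    (a : Fin m → ℝ) (α : ℝ) (W : ℕ → Fin m → Fin d → ℝ) : Prop :=
  ∀ n r, W (n + 1) r = W n r - α • gradLoss σ x y (W (n + 1)) a r

/-- The Taylor remainder vector `I₀(s)`, where the weights are `W = W(s)`: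
`I₀ⁱ = ∑_r ∫₀^α ⟨∂u_i/∂w_r(W + η ∂L/∂W) - ∂u_i/∂w_r(W), ∂L/∂w_r⟩ dη`. -/
def I0 {d m N : ℕ} (σ : ℝ → ℝ) (x : Fin N → Fin d → ℝ) (y : Fin N → ℝ)
    (a : Fin m → ℝ) (α : ℝ) (W : Fin m → Fin d → ℝ) : Fin N → ℝ :=
  fun i => ∑ r, ∫ η in (0:ℝ)..α,
    dot (gradU σ a (x i) (fun r' => W r' + η • gradLoss σ x y W a r') r
          - gradU σ a (x i) W r)
        (gradLoss σ x y W a r)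

end

theorem enorm2_nonneg {d : ℕ} (v : Fin d → ℝ) : 0 ≤ enorm2 v := Real.sqrt_nonneg _

theorem dot_sub_left {d : ℕ} (u v w : Fin d → ℝ) : dot (u - v) w = dot u w - dot v w := by
  simp [dot, sub_mul, Finset.sum_sub_distrib]

/-- Cauchy–Schwarz inequality. -/
theorem abs_dot_le {d : ℕ} (v w : Fin d → ℝ) : |dot v w| ≤ enorm2 v * enorm2 w := by
  rw [enorm2, enorm2, ← Real.sqrt_mul (Finset.sum_nonneg fun k _ => sq_nonneg (v k))]
  exact Real.abs_le_sqrt (Finset.sum_mul_sq_le_sq_mul_sq _ _ _)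

theorem abs_mul_sub_mul_le {c δ p q p' q' : ℝ} (hp : |p| ≤ c) (hq' : |q'| ≤ c)
    (hpp : |p - p'| ≤ δ) (hqq : |q - q'| ≤ δ) : |p * q - p' * q'| ≤ 2 * c * δ := by
  have hc : 0 ≤ c := (abs_nonneg p).trans hp
  have hδ : 0 ≤ δ := (abs_nonneg _).trans hpp
  calc |p * q - p' * q'| = |p * (q - q') + (p - p') * q'| := by ring_nf
    _ ≤ |p| * |q - q'| + |p - p'| * |q'| := by
        simpa only [abs_mul] using abs_add_le (p * (q - q')) ((p - p') * q')
    _ ≤ c * δ + δ * c := by gcongr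
    _ = 2 * c * δ := by ring

theorem abs_lipschitz_comp_dot_sub_le {d : ℕ} {f : ℝ → ℝ} {c C : ℝ} (hc : 0 ≤ c)
    (hf : ∀ z₁ z₂, |f z₁ - f z₂| ≤ c * |z₁ - z₂|) {x : Fin d → ℝ} (hx : enorm2 x ≤ C)
    (w w' : Fin d → ℝ) : |f (dot w x) - f (dot w' x)| ≤ c * (enorm2 (w - w') * C) := by
  refine (hf _ _).trans (mul_le_mul_of_nonneg_left ?_ hc)
  rw [← dot_sub_left]
  exact (abs_dot_le _ _).trans (mul_le_mul_of_nonneg_left hx (enorm2_nonneg _))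

/-- entrywise Lipschitz bound for the Gram matrix:
`|H_{ij}(W) - H_{ij}(W̃)| ≤ (C'/m) ∑_r ‖w_r - w̃_r‖₂`, with `C'` depending only
on `c` and `C`. -/
theorem gram_entry_lipschitz (c C : ℝ) (hc : 0 < c) (hC : 0 < C) :
    ∃ C' > 0, ∀ (d m N : ℕ) (σ : ℝ → ℝ),
      (∀ z, |deriv σ z| ≤ c) →
      (∀ z₁ z₂, |deriv σ z₁ - deriv σ z₂| ≤ c * |z₁ - z₂|) →
      ∀ (x : Fin N → Fin d → ℝ), (∀ i, enorm2 (x i) ≤ C) →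
      ∀ (W W' : Fin m → Fin d → ℝ) (i j : Fin N),
        |gram σ x W i j - gram σ x W' i j|
          ≤ C' / m * ∑ r, enorm2 (W r - W' r) := by
  refine ⟨2 * c ^ 2 * C ^ 3, by positivity, ?_⟩
  intro d m N σ hb hL x hx W W' i j
  have hdot : |dot (x i) (x j)| ≤ C * C :=
    (abs_dot_le _ _).trans (mul_le_mul (hx i) (hx j) (enorm2_nonneg _) hC.le)
  have hterm (r : Fin m) :
      |dot (x i) (x j) * deriv σ (dot (W r) (x i)) * deriv σ (dot (W r) (x j))
        - dot (x i) (x j) * deriv σ (dot (W' r) (x i)) * deriv σ (dot (W' r) (x j))|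
        ≤ 2 * c ^ 2 * C ^ 3 * enorm2 (W r - W' r) := by
    have hprod := abs_mul_sub_mul_le (hb (dot (W r) (x i))) (hb (dot (W' r) (x j)))
      (abs_lipschitz_comp_dot_sub_le hc.le hL (hx i) (W r) (W' r))
      (abs_lipschitz_comp_dot_sub_le hc.le hL (hx j) (W r) (W' r))
    rw [mul_assoc, mul_assoc, ← mul_sub, abs_mul]
    calc _ ≤ C * C * (2 * c * (c * (enorm2 (W r - W' r) * C))) :=
          mul_le_mul hdot hprod (abs_nonneg _) (by positivity)
      _ = _ := by ring
  rw [gram, gram, ← mul_sub, ← Finset.sum_sub_distrib, abs_mul,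
    abs_of_nonneg (show (0 : ℝ) ≤ 1 / m by positivity), div_eq_mul_one_div (2 * c ^ 2 * C ^ 3),
    mul_comm (2 * c ^ 2 * C ^ 3), mul_assoc (1 / (m : ℝ)), Finset.mul_sum]
  gcongr
  exact (Finset.abs_sum_le_sum_abs _ _).trans (Finset.sum_le_sum fun r _ => hterm r)
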